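/- Let Z ∈ Mₙ(ℂ)^d be an irreducible row contraction of row norm 1 and Y ∈ B(H)^d a row contraction. If the map ψ_{Y,Z}(T) = Σ_j Y_j T Z_j* on B(ℂⁿ, H) has 1 as an eigenvalue, then there exists an injective linear map T : ℂⁿ → H such that Y_j* T = T Z_j* for all j; in particular, there is an n-dimensional subspace K ⊆ H invariant under each Y_j* such that (Y_1*|_K, …, Y_d*|_K) is simultaneously similar to (Z_1*, …, Z_d*). -/

import Mathlib

open scoped Matrix ComplexOrder

section NormAttaining

variable {E F : Type*} [NormedAddCommGroup E] [InnerProductSpace ℂ E]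
  [NormedAddCommGroup F] [InnerProductSpace ℂ F]

/-- The vectors at which an operator between inner product spaces attains its norm form a
subspace. -/
def normAttainingSubmodule (T : E →L[ℂ] F) : Submodule ℂ E where
  carrier := {v | ‖T v‖ = ‖T‖ * ‖v‖}
  zero_mem' := by simp
  add_mem' {u v} hu hv := by
    simp only [Set.mem_ofPred_eq] at *
    have h1 := parallelogram_law_with_norm ℂ (T u) (T v)
    have h2 := parallelogram_law_with_norm ℂ u v
    rw [← map_add, ← map_sub, hu, hv] at h1
    have h3 := T.le_opNorm (u + v)
    have h4 := mul_self_le_mul_self (norm_nonneg _) (T.le_opNorm (u - v))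
    refine le_antisymm h3 (abs_le_of_sq_le_sq' ?_ (norm_nonneg _) |>.2)
    linear_combination h4 - h1 + ‖T‖ ^ 2 * h2
  smul_mem' a v hv := by
    simp only [Set.mem_ofPred_eq] at *
    rw [map_smul, norm_smul, norm_smul, hv]
    ring

theorem mem_normAttainingSubmodule {T : E →L[ℂ] F} {v : E} :
    v ∈ normAttainingSubmodule T ↔ ‖T v‖ = ‖T‖ * ‖v‖ := Iff.rfl

theorem exists_ne_zero_mem_normAttainingSubmodule [FiniteDimensional ℂ E]
    {T : E →L[ℂ] F} (hT : T ≠ 0) : ∃ v ∈ normAttainingSubmodule T, v ≠ 0 := by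
  have : ProperSpace E := FiniteDimensional.proper ℂ E
  have hne : ∃ x : E, x ≠ 0 := by
    by_contra! h
    exact hT (ContinuousLinearMap.ext fun x => by simp [h x])
  obtain ⟨x, hx⟩ := hne
  have : Nontrivial E := ⟨x, 0, hx⟩
  have hs : (Metric.sphere (0 : E) 1).Nonempty :=
    ⟨((‖x‖⁻¹ : ℝ) : ℂ) • x, by simp [norm_smul, hx]⟩
  obtain ⟨v, hv, hmax⟩ := (isCompact_sphere (0 : E) 1).exists_isMaxOn hs
    (f := fun v => ‖T v‖) (by fun_prop)
  have hv1 : ‖v‖ = 1 := by simpa using hv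
  refine ⟨v, ?_, by rintro rfl; simp at hv1⟩
  rw [mem_normAttainingSubmodule, hv1, mul_one]
  refine le_antisymm (by simpa [hv1] using T.le_opNorm v) ?_
  refine T.opNorm_le_of_unit_norm (𝕜 := ℂ) (norm_nonneg _) fun y hy => ?_
  exact hmax (by simpa using hy)

/-- If a row of operators `W` satisfies `∑ ‖W_j v‖² ≤ ‖v‖²`, `Y` is a row contraction and
`∑ Y_j T W_j = T`, then at norm-attaining vectors of `T` the operator `T` intertwines `W_j` with
`Y_j*`, and `W_j` preserves these vectors. -/
theorem intertwines_of_mem_normAttainingSubmodule [CompleteSpace F] {ι : Type*} [Fintype ι]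
    {W : ι → E →L[ℂ] E} {Y : ι → F →L[ℂ] F} {T : E →L[ℂ] F}
    (hW : ∀ v, ∑ j, ‖W j v‖ ^ 2 ≤ ‖v‖ ^ 2)
    (hY : ∀ x, ∑ j, ‖star (Y j) x‖ ^ 2 ≤ ‖x‖ ^ 2)
    (hT : ∑ j, (Y j) ∘L T ∘L W j = T) {v : E} (hv : v ∈ normAttainingSubmodule T) (j : ι) :
    star (Y j) (T v) = T (W j v) ∧ W j v ∈ normAttainingSubmodule T := by
  rw [mem_normAttainingSubmodule] at hv
  have hcross : ∑ j, RCLike.re (inner ℂ (star (Y j) (T v)) (T (W j v))) = ‖T v‖ ^ 2 := by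
    have h : T v = ∑ j, Y j (T (W j v)) := by
      conv_lhs => rw [← hT]
      simp
    simp only [ContinuousLinearMap.star_eq_adjoint, ContinuousLinearMap.adjoint_inner_left]
    rw [← map_sum, ← inner_sum, ← h, inner_self_eq_norm_sq]
  have hsq (i : ι) : ‖T (W i v)‖ ^ 2 ≤ ‖T‖ ^ 2 * ‖W i v‖ ^ 2 := by
    rw [← mul_pow]
    exact pow_le_pow_left₀ (norm_nonneg _) (T.le_opNorm _) 2
  have hdiff : ∑ j, ‖star (Y j) (T v) - T (W j v)‖ ^ 2
      + ∑ j, (‖T‖ ^ 2 * ‖W j v‖ ^ 2 - ‖T (W j v)‖ ^ 2) ≤ 0 := by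
    simp only [norm_sub_sq (𝕜 := ℂ), Finset.sum_add_distrib, Finset.sum_sub_distrib,
      ← Finset.mul_sum, hcross]
    have h1 := hY (T v)
    have h2 := mul_le_mul_of_nonneg_left (hW v) (sq_nonneg ‖T‖)
    have h3 : ‖T v‖ ^ 2 = ‖T‖ ^ 2 * ‖v‖ ^ 2 := by rw [hv, mul_pow]
    linarith
  have hA : ∀ i, 0 ≤ ‖star (Y i) (T v) - T (W i v)‖ ^ 2 := fun i => sq_nonneg _
  have hB : ∀ i, 0 ≤ ‖T‖ ^ 2 * ‖W i v‖ ^ 2 - ‖T (W i v)‖ ^ 2 := fun i => sub_nonneg.2 (hsq i)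
  have hAj := Finset.single_le_sum (fun i _ => hA i) (Finset.mem_univ j)
  have hBj := Finset.single_le_sum (fun i _ => hB i) (Finset.mem_univ j)
  have hA0 : ‖star (Y j) (T v) - T (W j v)‖ ^ 2 = 0 := by linarith [hA j, hB j]
  have hB0 : ‖T‖ ^ 2 * ‖W j v‖ ^ 2 - ‖T (W j v)‖ ^ 2 = 0 := by linarith [hA j, hB j]
  refine ⟨sub_eq_zero.1 (by simpa using hA0), ?_⟩
  rw [mem_normAttainingSubmodule, ← sq_eq_sq₀ (by positivity) (by positivity), mul_pow]
  linarith

end NormAttaining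

/-- A row contraction `Y` satisfies `∑ ‖Y_j* x‖² ≤ ‖x‖²`. -/
theorem sum_norm_star_apply_sq_le {F ι : Type*} [NormedAddCommGroup F] [InnerProductSpace ℂ F]
    [CompleteSpace F] [Fintype ι] {Y : ι → F →L[ℂ] F}
    (hY : (1 - ∑ j, Y j * star (Y j)).IsPositive) (x : F) :
    ∑ j, ‖star (Y j) x‖ ^ 2 ≤ ‖x‖ ^ 2 := by
  have h := hY.re_inner_nonneg_right x
  have hj (j : ι) : RCLike.re (inner ℂ x ((Y j * star (Y j)) x)) = ‖star (Y j) x‖ ^ 2 := by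
    rw [ContinuousLinearMap.mul_def, ContinuousLinearMap.comp_apply,
      ← inner_self_eq_norm_sq (𝕜 := ℂ), ContinuousLinearMap.star_eq_adjoint,
      ContinuousLinearMap.adjoint_inner_left]
  simp only [sub_apply, one_apply_eq_self, sum_apply, inner_sub_right, inner_sum, map_sub, map_sum,
    hj, inner_self_eq_norm_sq] at h
  linarith

/-- A nonzero subspace invariant under the adjoints of an irreducible tuple of matrices is the
whole space. -/
theorem eq_top_of_adjoin_eq_top_of_star_invariant {ι m : Type*} [Fintype m] [DecidableEq m]
    {Z : ι → Matrix m m ℂ} (hZ : Algebra.adjoin ℂ (Set.range Z) = ⊤)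
    {p : Submodule ℂ (EuclideanSpace ℂ m)} (hp : ∃ v ∈ p, v ≠ 0)
    (hinv : ∀ j, ∀ v ∈ p, star (Matrix.toEuclideanCLM (𝕜 := ℂ) (Z j)) v ∈ p) : p = ⊤ := by
  have hall (A : Matrix m m ℂ) : ∀ v ∈ p, star (Matrix.toEuclideanCLM (𝕜 := ℂ) A) v ∈ p := by
    have hA : A ∈ Algebra.adjoin ℂ (Set.range Z) := hZ ▸ Algebra.mem_top
    induction hA using Algebra.adjoin_induction with
    | mem x hx => obtain ⟨j, rfl⟩ := hx; exact hinv j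
    | algebraMap r =>
      intro v hv
      rw [Algebra.algebraMap_eq_smul_one, map_smul, map_one, star_smul, star_one]
      exact p.smul_mem _ hv
    | add x y _ _ hx hy =>
      intro v hv
      rw [← map_star, star_add, map_add, map_star, map_star]
      exact p.add_mem (hx v hv) (hy v hv)
    | mul x y _ _ hx hy =>
      intro v hv
      rw [map_mul, star_mul]
      exact hy _ (hx v hv)
  obtain ⟨v, hv, hv0⟩ := hp
  refine eq_top_iff.2 fun w _ => ?_
  let B : EuclideanSpace ℂ m →L[ℂ] EuclideanSpace ℂ m := (innerSL ℂ v).smulRight w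
  have h := hall ((Matrix.toEuclideanCLM (𝕜 := ℂ) (n := m)).symm (star B)) v hv
  rw [StarAlgEquiv.apply_symm_apply, star_star] at h
  have hB : B v = (inner ℂ v v : ℂ) • w := by simp [B]
  rw [hB] at h
  exact (p.smul_mem_iff (inner_self_ne_zero.2 hv0)).1 h

/-- If `Z` is an irreducible row contraction of row norm `1` and `Y` a row contraction
such that `ψ_{Y,Z}(T) = ∑ Y_j T Z_j*` has `1` as an eigenvalue, then there is an injective
intertwiner `T` with `Y_j* T = T Z_j*` for all `j` (whose range is thus an `n`-dimensional
`Y*`-coinvariant subspace on which `Y*` is similar to `Z*`). -/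
theorem stmt_7 {d n : ℕ}
    {H : Type*} [NormedAddCommGroup H] [InnerProductSpace ℂ H] [CompleteSpace H]
    (Z : Fin d → Matrix (Fin n) (Fin n) ℂ) (Y : Fin d → H →L[ℂ] H)
    (hZ : Matrix.PosSemidef (1 - ∑ j, Z j * (Z j)ᴴ))
    (hZnorm : (1 : ℂ) ∈ spectrum ℂ (∑ j, Z j * (Z j)ᴴ))
    (hZirr : Algebra.adjoin ℂ (Set.range Z) = ⊤)
    (hY : (1 - ∑ j, Y j * star (Y j)).IsPositive)
    (heig : ∃ T : EuclideanSpace ℂ (Fin n) →L[ℂ] H, T ≠ 0 ∧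
      ∑ j, (Y j) ∘L T ∘L star (Matrix.toEuclideanCLM (𝕜 := ℂ) (Z j)) = T) :
    ∃ T : EuclideanSpace ℂ (Fin n) →L[ℂ] H, Function.Injective T ∧
      ∀ j, star (Y j) ∘L T = T ∘L star (Matrix.toEuclideanCLM (𝕜 := ℂ) (Z j)) := by
  obtain ⟨T, hT0, hT⟩ := heig
  have hpos : (1 - ∑ j, Matrix.toEuclideanCLM (𝕜 := ℂ) (Z j) *
      star (Matrix.toEuclideanCLM (𝕜 := ℂ) (Z j))).IsPositive := by
    have h := Matrix.isPositive_toEuclideanLin_iff.2 hZ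
    rw [← ContinuousLinearMap.isPositive_toLinearMap_iff]
    convert h using 1
    simp_rw [← map_star, ← map_mul, ← map_sum]
    rw [← map_one (Matrix.toEuclideanCLM (𝕜 := ℂ) (n := Fin n)), ← map_sub]
    rfl
  have hint := fun v (hv : v ∈ normAttainingSubmodule T) j =>
    intertwines_of_mem_normAttainingSubmodule (sum_norm_star_apply_sq_le hpos)
      (sum_norm_star_apply_sq_le hY) hT hv j
  have htop : normAttainingSubmodule T = ⊤ :=
    eq_top_of_adjoin_eq_top_of_star_invariant hZirr
      (exists_ne_zero_mem_normAttainingSubmodule hT0) fun j v hv => (hint v hv j).2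
  have hmem (v : EuclideanSpace ℂ (Fin n)) : v ∈ normAttainingSubmodule T :=
    htop ▸ Submodule.mem_top
  refine ⟨T, ?_, fun j => ContinuousLinearMap.ext fun v => (hint v (hmem v) j).1⟩
  refine (injective_iff_map_eq_zero T).2 fun v hv => ?_
  have h := mem_normAttainingSubmodule.1 (hmem v)
  rw [hv, norm_zero, eq_comm, mul_eq_zero] at h
  exact norm_eq_zero.1 (h.resolve_left (norm_ne_zero_iff.2 hT0))
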